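/- arXiv:1604.05695 — 5 statements merged into one kernel-verified Lean document; each statement's English description precedes it below -/
import Mathlib

section
/- Let G be a gyrogroup and let A be a nonempty subset of G. Then there exists a unique normal subgyrogroup ⟨⟨A⟩⟩ of G such that (1) A ⊆ ⟨⟨A⟩⟩, and (2) whenever N is a normal subgyrogroup of G with A ⊆ N, one has ⟨⟨A⟩⟩ ⊆ N. -/
universe u v

/-- A gyrogroup: a groupoid `(G, +)` with a left identity `0`, left inverses `-a`,
gyroautomorphisms `gyr a b` (automorphisms of `(G, +)`) satisfying the left
gyroassociative law, and the left loop property. -/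
class Gyrogroup (G : Type u) extends Add G, Zero G, Neg G where
  /-- (G1) left identity -/
  zero_add' : ∀ a : G, 0 + a = a
  /-- (G2) left inverse -/
  neg_add' : ∀ a : G, -a + a = 0
  /-- (G3) the gyroautomorphisms, as bijections of `G` -/
  gyr : G → G → G ≃ G
  /-- (G3) each `gyr a b` preserves the operation, i.e. is an automorphism -/
  gyr_add' : ∀ a b x y : G, gyr a b (x + y) = gyr a b x + gyr a b y
  /-- (G3) left gyroassociative law -/
  add_gyr_assoc' : ∀ a b c : G, a + (b + c) = (a + b) + gyr a b c
  /-- (G4) left loop property -/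
  left_loop' : ∀ a b : G, gyr (a + b) b = gyr a b

open Gyrogroup

variable {G : Type u}

/-- A subgyrogroup: a nonempty subset closed under the operation and inverses. -/
structure IsSubgyrogroup [Gyrogroup G] (H : Set G) : Prop where
  nonempty : H.Nonempty
  add_mem : ∀ ⦃a : G⦄, a ∈ H → ∀ ⦃b : G⦄, b ∈ H → a + b ∈ H
  neg_mem : ∀ ⦃a : G⦄, a ∈ H → -a ∈ H

/-- A gyrogroup homomorphism: a map preserving the operation. -/
def IsGyroHom [Gyrogroup G] {A : Type v} [Gyrogroup A] (φ : G → A) : Prop :=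
  ∀ x y : G, φ (x + y) = φ x + φ y

/-- The kernel of a map into a gyrogroup. -/
def gyroKer [Gyrogroup G] {A : Type v} [Gyrogroup A] (φ : G → A) : Set G :=
  {x : G | φ x = 0}

/-- A normal subgyrogroup: the kernel of some gyrogroup homomorphism from `G`. -/
def IsNormalSubgyrogroup [Gyrogroup G] (N : Set G) : Prop :=
  IsSubgyrogroup N ∧ ∃ (A : Type u) (instA : Gyrogroup A) (φ : G → A),
    @IsGyroHom G _ A instA φ ∧ N = @gyroKer G _ A instA φ

/-- The gyrocommutator `[a, b] = -(a + b) + gyr a b (b + a)`. -/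
def gyroCommutator [Gyrogroup G] (a b : G) : G :=
  -(a + b) + gyr a b (b + a)

/-- The set of all gyrocommutators of `G`. -/
def gyroCommutatorSet (G : Type u) [Gyrogroup G] : Set G :=
  {x : G | ∃ a b : G, x = gyroCommutator a b}

/-- `K` is the commutator subgyrogroup `G'` of `G`: the smallest subgyrogroup
containing all commutators. -/
def IsCommutatorSubgyrogroup [Gyrogroup G] (K : Set G) : Prop :=
  IsSubgyrogroup K ∧ gyroCommutatorSet G ⊆ K ∧
    ∀ H : Set G, IsSubgyrogroup H → gyroCommutatorSet G ⊆ H → K ⊆ H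

/-- `K` is the normal closure `⟨⟨A⟩⟩` of `A`: the smallest normal subgyrogroup
containing `A`. -/
def IsGyroNormalClosure [Gyrogroup G] (A K : Set G) : Prop :=
  IsNormalSubgyrogroup K ∧ A ⊆ K ∧
    ∀ N : Set G, IsNormalSubgyrogroup N → A ⊆ N → K ⊆ N

/-- The left coset `a ⊕ H`. -/
def lcoset [Gyrogroup G] (a : G) (H : Set G) : Set G := (a + ·) '' H

/-- The right coset `H ⊕ a`. -/
def rcoset [Gyrogroup G] (H : Set G) (a : G) : Set G := (· + a) '' H

/-- A gyrogroup is gyrocommutative if `a + b = gyr a b (b + a)` for all `a, b`. -/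
def IsGyrocommutative (G : Type u) [Gyrogroup G] : Prop :=
  ∀ a b : G, a + b = gyr a b (b + a)

/-- An L-subgyrogroup: a subgyrogroup with `gyr a h (H) = H` for all `a ∈ G`, `h ∈ H`. -/
def IsLSubgyrogroup [Gyrogroup G] (H : Set G) : Prop :=
  IsSubgyrogroup H ∧ ∀ a : G, ∀ h ∈ H, ⇑(gyr a h) '' H = H

/-- A subgroup of a gyrogroup: a subgyrogroup that forms a group under the gyrogroup
operation (equivalently, on which the operation is associative; together with the
closure properties and the identity and inverses inherited from `G`, this makes it
a group). -/
def IsSubgroupOfGyrogroup [Gyrogroup G] (H : Set G) : Prop :=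
  IsSubgyrogroup H ∧ ∀ a ∈ H, ∀ b ∈ H, ∀ c ∈ H, a + (b + c) = (a + b) + c

/-- The left nucleus of `G`. -/
def leftNucleus (G : Type u) [Gyrogroup G] : Set G :=
  {a : G | ∀ b c : G, a + (b + c) = (a + b) + c}

/-- The middle nucleus of `G`. -/
def middleNucleus (G : Type u) [Gyrogroup G] : Set G :=
  {b : G | ∀ a c : G, a + (b + c) = (a + b) + c}

/-- The right nucleus of `G`. -/
def rightNucleus (G : Type u) [Gyrogroup G] : Set G :=
  {c : G | ∀ a b : G, a + (b + c) = (a + b) + c}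

/-- `L(G)`: the set of left gyrotranslations of `G`, viewed as permutations of `G`.
A permutation `σ` is a left gyrotranslation when `σ x = a + x` for some fixed `a`. -/
def LSet (G : Type u) [Gyrogroup G] : Set (Equiv.Perm G) :=
  {σ : Equiv.Perm G | ∃ a : G, ∀ x : G, σ x = a + x}

/-- `L(H)` for a subset `H ⊆ G`: the left gyrotranslations by elements of `H`. -/
def LSetOf [Gyrogroup G] (H : Set G) : Set (Equiv.Perm G) :=
  {σ : Equiv.Perm G | ∃ a ∈ H, ∀ x : G, σ x = a + x}

/-- The left multiplication group `LMlt(G)`: the subgroup of `Sym(G)` generated by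
the left gyrotranslations. -/
def LMlt (G : Type u) [Gyrogroup G] : Subgroup (Equiv.Perm G) :=
  Subgroup.closure (LSet G)

/-- `L(G)'`: the set of products `L_{a₁} ∘ ⋯ ∘ L_{aₙ}` of left gyrotranslations whose
reversed product `L_{aₙ} ∘ ⋯ ∘ L_{a₁}` is the identity. -/
def LPrime (G : Type u) [Gyrogroup G] : Set (Equiv.Perm G) :=
  {σ : Equiv.Perm G | ∃ l : List (Equiv.Perm G),
    (∀ τ ∈ l, τ ∈ LSet G) ∧ σ = l.prod ∧ l.reverse.prod = 1}

/-- `L(G)^# = ⋂_{a ∈ G} L_a ∘ L(G)`. -/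
def LSharp (G : Type u) [Gyrogroup G] : Set (Equiv.Perm G) :=
  {σ : Equiv.Perm G | ∀ ρ ∈ LSet G, ∃ τ ∈ LSet G, σ = ρ * τ}

/-- The radical of `G`: elements whose left gyrotranslation lies in `L(G)'`. -/
def gyroRadical (G : Type u) [Gyrogroup G] : Set G :=
  {a : G | ∃ σ ∈ LPrime G, ∀ x : G, σ x = a + x}

/-- `X` is a normal subgroup of the subgroup `Γ` (as a subset of the ambient group). -/
def IsNormalSubgroupIn {M : Type v} [Group M] (Γ : Subgroup M) (X : Set M) : Prop :=
  X ⊆ (Γ : Set M) ∧ (1 : M) ∈ X ∧ (∀ σ ∈ X, σ⁻¹ ∈ X) ∧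
    (∀ σ ∈ X, ∀ τ ∈ X, σ * τ ∈ X) ∧ ∀ γ ∈ Γ, ∀ σ ∈ X, γ * σ * γ⁻¹ ∈ X

/-- The coaddition `a ⊞ b = a + gyr a (-b) b`. -/
def gyroCoadd [Gyrogroup G] (a b : G) : G := a + gyr a (-b) b

/-- Natural-number multiples: `0 • a = 0`, `(m+1) • a = a + m • a`. -/
def gyroNsmul [Gyrogroup G] : ℕ → G → G
  | 0, _ => 0
  | n + 1, a => a + gyroNsmul n a

/-- The index `[G : H]`: the number of left cosets of `H` in `G`. -/
noncomputable def gyroIndex [Gyrogroup G] (H : Set G) : ℕ :=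
  Set.ncard {S : Set G | ∃ a : G, S = lcoset a H}

/-- The product of a family of gyrogroups, with componentwise operations. -/
instance Gyrogroup.pi {ι : Type*} {B : ι → Type*} [∀ i, Gyrogroup (B i)] :
    Gyrogroup (∀ i, B i) where
  add f g i := f i + g i
  zero _ := 0
  neg f i := -f i
  zero_add' _ := funext fun _ => zero_add' _
  neg_add' _ := funext fun _ => neg_add' _
  gyr f g := Equiv.piCongrRight fun i => gyr (f i) (g i)
  gyr_add' _ _ _ _ := funext fun _ => gyr_add' _ _ _ _
  add_gyr_assoc' _ _ _ := funext fun _ => add_gyr_assoc' _ _ _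
  left_loop' _ _ := Equiv.ext fun _ => funext fun _ =>
    congrArg (fun e : Equiv.Perm _ => e _) (left_loop' _ _)

theorem IsSubgyrogroup.zero_mem [Gyrogroup G] {H : Set G} (hH : IsSubgyrogroup H) :
    (0 : G) ∈ H := by
  obtain ⟨a, ha⟩ := hH.nonempty
  simpa only [Gyrogroup.neg_add'] using hH.add_mem (hH.neg_mem ha) ha

theorem IsSubgyrogroup.sInter [Gyrogroup G] {S : Set (Set G)}
    (hS : ∀ H ∈ S, IsSubgyrogroup H) : IsSubgyrogroup (⋂₀ S) where
  nonempty := ⟨0, fun H hH => (hS H hH).zero_mem⟩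
  add_mem _ ha _ hb H hH := (hS H hH).add_mem (ha H hH) (hb H hH)
  neg_mem _ ha H hH := (hS H hH).neg_mem (ha H hH)

/-- An intersection of kernels is the kernel of the induced map into the product. -/
theorem IsNormalSubgyrogroup.sInter [Gyrogroup G] {S : Set (Set G)}
    (hS : ∀ N ∈ S, IsNormalSubgyrogroup N) : IsNormalSubgyrogroup (⋂₀ S) := by
  refine ⟨IsSubgyrogroup.sInter fun N hN => (hS N hN).1, ?_⟩
  choose B instB φ hφ hker using fun N : S => (hS N N.2).2
  refine ⟨∀ N : S, B N, Gyrogroup.pi, fun x N => φ N x,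
    fun x y => funext fun N => hφ N x y, ?_⟩
  ext x
  have mem_iff (N : S) : x ∈ (N : Set G) ↔ φ N x = 0 := by
    rw [hker N]
    rfl
  exact ⟨fun hx => funext fun N => (mem_iff N).1 (hx N N.2),
    fun hx N hN => (mem_iff ⟨N, hN⟩).2 (congrFun hx ⟨N, hN⟩)⟩

/-- every nonempty subset `A` of a gyrogroup `G` has a unique normal
closure: a normal subgyrogroup containing `A` and contained in every normal
subgyrogroup containing `A`. -/
theorem exists_unique_normal_closure [Gyrogroup G] (A : Set G) (hA : A.Nonempty) :
    ∃! K : Set G, IsNormalSubgyrogroup K ∧ A ⊆ K ∧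
      ∀ N : Set G, IsNormalSubgyrogroup N → A ⊆ N → K ⊆ N := by
  refine ⟨⋂₀ {N | IsNormalSubgyrogroup N ∧ A ⊆ N},
    ⟨IsNormalSubgyrogroup.sInter fun N hN => hN.1, Set.subset_sInter fun N hN => hN.2,
      fun N hN hAN => Set.sInter_subset_of_mem ⟨hN, hAN⟩⟩, ?_⟩
  rintro K ⟨hK, hAK, hmin⟩
  exact Set.Subset.antisymm (Set.subset_sInter fun N hN => hmin N hN.1 hN.2)
    (Set.sInter_subset_of_mem ⟨hK, hAK⟩)
end

section
/- Let G be a gyrogroup with commutator subgyrogroup G′. If τ is an automorphism of G, then τ(G′) = G′. -/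
universe u v

open Gyrogroup

variable {G : Type u}

namespace Gyrogroup

variable [Gyrogroup G]

theorem add_left_cancel' {a b c : G} (h : a + b = a + c) : b = c := by
  have key : -a + (a + b) = -a + (a + c) := by rw [h]
  rw [add_gyr_assoc', add_gyr_assoc', neg_add', zero_add', zero_add'] at key
  exact (gyr (-a) a).injective key

theorem gyr_zero_left (a c : G) : gyr 0 a c = c := by
  have h := add_gyr_assoc' 0 a c
  rw [zero_add', zero_add'] at h
  exact (add_left_cancel' h).symm

theorem neg_add_cancel_left' (a b : G) : -a + (a + b) = b := by
  rw [add_gyr_assoc', ← left_loop', neg_add', zero_add', gyr_zero_left]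

theorem add_zero' (a : G) : a + 0 = a :=
  add_left_cancel' (a := -a) (by rw [neg_add_cancel_left', neg_add'])

theorem add_neg' (a : G) : a + -a = 0 :=
  add_left_cancel' (a := -a) (by rw [neg_add_cancel_left', add_zero'])

theorem eq_neg_of_add_eq_zero {x a : G} (h : x + a = 0) : x = -a := by
  have hx : -x = a := by rw [← neg_add_cancel_left' x a, h, add_zero']
  exact add_left_cancel' (a := a) (by rw [add_neg', ← hx, neg_add'])

end Gyrogroup

namespace IsGyroHom

variable [Gyrogroup G] {A : Type v} [Gyrogroup A] {φ : G → A}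

theorem map_zero (hφ : IsGyroHom φ) : φ 0 = 0 :=
  add_left_cancel' (a := φ 0) (by rw [← hφ, add_zero', add_zero'])

theorem map_neg (hφ : IsGyroHom φ) (a : G) : φ (-a) = -φ a :=
  eq_neg_of_add_eq_zero (by rw [← hφ, Gyrogroup.neg_add', hφ.map_zero])

theorem map_gyr (hφ : IsGyroHom φ) (a b c : G) :
    φ (gyr a b c) = gyr (φ a) (φ b) (φ c) := by
  apply add_left_cancel' (a := φ a + φ b)
  rw [← add_gyr_assoc', ← hφ, ← hφ, ← add_gyr_assoc', hφ, hφ]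

theorem map_gyroCommutator (hφ : IsGyroHom φ) (a b : G) :
    φ (gyroCommutator a b) = gyroCommutator (φ a) (φ b) := by
  rw [gyroCommutator, gyroCommutator, hφ, hφ.map_neg, hφ.map_gyr, hφ, hφ]

end IsGyroHom

namespace IsSubgyrogroup

variable [Gyrogroup G] {A : Type v} [Gyrogroup A] {φ : G → A}

theorem zero_mem_s2 {H : Set G} (hH : IsSubgyrogroup H) : (0 : G) ∈ H := by
  obtain ⟨a, ha⟩ := hH.nonempty
  simpa only [Gyrogroup.neg_add'] using hH.add_mem (hH.neg_mem ha) ha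

theorem preimage {H : Set A} (hH : IsSubgyrogroup H) (hφ : IsGyroHom φ) :
    IsSubgyrogroup (φ ⁻¹' H) where
  nonempty := ⟨0, by simpa only [Set.mem_preimage, hφ.map_zero] using hH.zero_mem_s2⟩
  add_mem a ha b hb := by
    simpa only [Set.mem_preimage, hφ a b] using hH.add_mem ha hb
  neg_mem a ha := by
    simpa only [Set.mem_preimage, hφ.map_neg] using hH.neg_mem ha

theorem image {H : Set G} (hH : IsSubgyrogroup H) (hφ : IsGyroHom φ) :
    IsSubgyrogroup (φ '' H) where
  nonempty := hH.nonempty.image φ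
  add_mem := by
    rintro _ ⟨a, ha, rfl⟩ _ ⟨b, hb, rfl⟩
    exact ⟨a + b, hH.add_mem ha hb, hφ a b⟩
  neg_mem := by
    rintro _ ⟨a, ha, rfl⟩
    exact ⟨-a, hH.neg_mem ha, hφ.map_neg a⟩

end IsSubgyrogroup

/-- the commutator subgyrogroup is invariant under every automorphism. -/
theorem automorphism_image_commutator_subgyrogroup [Gyrogroup G]
    (K : Set G) (hK : IsCommutatorSubgyrogroup K)
    (τ : G → G) (hbij : Function.Bijective τ)
    (hadd : ∀ a b : G, τ (a + b) = τ a + τ b) :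
    τ '' K = K := by
  have hτ : IsGyroHom τ := hadd
  obtain ⟨hsub, hcomm, hmin⟩ := hK
  apply Set.Subset.antisymm
  · rw [Set.image_subset_iff]
    refine hmin _ (hsub.preimage hτ) ?_
    rintro _ ⟨a, b, rfl⟩
    exact hcomm ⟨τ a, τ b, hτ.map_gyroCommutator a b⟩
  · refine hmin _ (hsub.image hτ) ?_
    rintro _ ⟨a, b, rfl⟩
    obtain ⟨a, rfl⟩ := hbij.surjective a
    obtain ⟨b, rfl⟩ := hbij.surjective b
    exact ⟨gyroCommutator a b, hcomm ⟨a, b, rfl⟩, hτ.map_gyroCommutator a b⟩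
end

section
/- Let G be a gyrogroup and let N be a normal subgyrogroup of G. The following are equivalent: (1) the quotient gyrogroup G/N is gyrocommutative, i.e., (a⊕b)⊕N = (gyr[a,b](b⊕a))⊕N for all a,b∈G; (2) G′ ⊆ N; (3) [a,b] ∈ N for all a,b∈G. -/
universe u v

open Gyrogroup

variable {G : Type u}

namespace Gyrogroup

variable [Gyrogroup G]

theorem add_neg_cancel_left' (a b : G) : a + (-a + b) = b :=
  add_left_cancel' (neg_add_cancel_left' a (-a + b))

theorem neg_add_eq_zero' {a b : G} : -a + b = 0 ↔ b = a := by
  constructor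
  · intro h
    rw [← add_neg_cancel_left' a b, h, add_zero']
  · rintro rfl
    exact neg_add' b

end Gyrogroup

section Hom

variable [Gyrogroup G] {A : Type v} [Gyrogroup A] {φ : G → A}

theorem IsGyroHom.map_zero_s5 (hφ : IsGyroHom φ) : φ 0 = 0 := by
  apply add_left_cancel' (a := φ 0)
  rw [← hφ, zero_add', add_zero']

theorem IsGyroHom.map_neg_add (hφ : IsGyroHom φ) (a b : G) : φ (-a + b) = -φ a + φ b := by
  apply add_left_cancel' (a := φ a)
  rw [← hφ, add_neg_cancel_left', add_neg_cancel_left']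

theorem IsGyroHom.neg_add_mem_gyroKer (hφ : IsGyroHom φ) {a b : G} :
    -a + b ∈ gyroKer φ ↔ φ b = φ a := by
  rw [gyroKer, Set.mem_ofPred_eq, hφ.map_neg_add, neg_add_eq_zero']

theorem mem_lcoset_iff {a b : G} {H : Set G} : b ∈ lcoset a H ↔ -a + b ∈ H := by
  constructor
  · rintro ⟨h, hh, rfl⟩
    simpa only [neg_add_cancel_left'] using hh
  · exact fun h => ⟨-a + b, h, add_neg_cancel_left' a b⟩

theorem IsGyroHom.lcoset_gyroKer_eq_iff (hφ : IsGyroHom φ) {a b : G} :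
    lcoset a (gyroKer φ) = lcoset b (gyroKer φ) ↔ -a + b ∈ gyroKer φ := by
  simp only [Set.ext_iff, mem_lcoset_iff, hφ.neg_add_mem_gyroKer]
  exact ⟨fun h => (h b).mpr rfl, fun h x => by rw [h]⟩

end Hom

theorem IsCommutatorSubgyrogroup.subset_iff [Gyrogroup G] {K H : Set G}
    (hK : IsCommutatorSubgyrogroup K) (hH : IsSubgyrogroup H) :
    K ⊆ H ↔ ∀ a b : G, gyroCommutator a b ∈ H := by
  constructor
  · exact fun h a b => h (hK.2.1 ⟨a, b, rfl⟩)
  · intro h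
    refine hK.2.2 H hH ?_
    rintro _ ⟨a, b, rfl⟩
    exact h a b

/-- for a normal subgyrogroup `N`, the following are equivalent:
(1) `G/N` is gyrocommutative, i.e. `(a+b) ⊕ N = (gyr a b (b+a)) ⊕ N` for all `a, b`;
(2) `G' ⊆ N`; (3) every commutator lies in `N`. -/
theorem quotient_gyrocommutative_iff_commutators_in_normal [Gyrogroup G]
    (K : Set G) (hK : IsCommutatorSubgyrogroup K)
    (N : Set G) (hN : IsNormalSubgyrogroup N) :
    ((∀ a b : G, lcoset (a + b) N = lcoset (gyr a b (b + a)) N) ↔ K ⊆ N) ∧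
    (K ⊆ N ↔ ∀ a b : G, gyroCommutator a b ∈ N) := by
  have hKN := hK.subset_iff hN.1
  refine ⟨?_, hKN⟩
  obtain ⟨-, A, _, φ, hφ, rfl⟩ := hN
  rw [hKN]
  exact forall₂_congr fun a b => hφ.lcoset_gyroKer_eq_iff
end

section
/- Let G be a gyrogroup and let N be a normal subgyrogroup of G. Then the quotient gyrogroup G/N is gyrocommutative (i.e., (a⊕b)⊕N = (gyr[a,b](b⊕a))⊕N for all a,b∈G) if and only if ⟨⟨G′⟩⟩ ⊆ N, where ⟨⟨G′⟩⟩ is the normal closure of the commutator subgyrogroup G′. -/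
universe u v

open Gyrogroup

variable {G : Type u}

theorem Gyrogroup.add_left_cancel'_s7 [Gyrogroup G] {a b c : G} (h : a + b = a + c) : b = c := by
  have h' : -a + (a + b) = -a + (a + c) := by rw [h]
  rw [add_gyr_assoc', add_gyr_assoc', Gyrogroup.neg_add', zero_add', zero_add'] at h'
  exact (gyr (-a) a).injective h'

theorem Gyrogroup.gyr_zero_left_s7 [Gyrogroup G] (a b : G) : gyr 0 a b = b := by
  have h := add_gyr_assoc' 0 a b
  rw [zero_add', zero_add'] at h
  exact (add_left_cancel'_s7 h).symm

theorem Gyrogroup.gyr_neg_self [Gyrogroup G] (a b : G) : gyr (-a) a b = b := by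
  rw [← left_loop', Gyrogroup.neg_add', gyr_zero_left_s7]

theorem Gyrogroup.neg_add_cancel_left'_s7 [Gyrogroup G] (a b : G) : -a + (a + b) = b := by
  rw [add_gyr_assoc', Gyrogroup.neg_add', zero_add', gyr_neg_self]

theorem Gyrogroup.add_neg_cancel_left'_s7 [Gyrogroup G] (a b : G) : a + (-a + b) = b := by
  apply add_left_cancel'_s7 (a := -a)
  rw [neg_add_cancel_left'_s7]

theorem Gyrogroup.add_zero'_s7 [Gyrogroup G] (a : G) : a + 0 = a := by
  apply add_left_cancel'_s7 (a := -a)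
  rw [neg_add_cancel_left'_s7, Gyrogroup.neg_add']

theorem IsGyroHom.map_zero_s7 [Gyrogroup G] {A : Type v} [Gyrogroup A] {φ : G → A}
    (hφ : IsGyroHom φ) : φ 0 = 0 := by
  apply add_left_cancel'_s7 (a := φ 0)
  rw [← hφ, zero_add', add_zero'_s7]

theorem IsGyroHom.neg_add_mem_gyroKer_iff [Gyrogroup G] {A : Type v} [Gyrogroup A] {φ : G → A}
    (hφ : IsGyroHom φ) (x y : G) : -x + y ∈ gyroKer φ ↔ φ x = φ y := by
  have hx : φ (-x) + φ x = 0 := by rw [← hφ, Gyrogroup.neg_add', hφ.map_zero_s7]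
  change φ (-x + y) = 0 ↔ _
  rw [hφ, ← hx]
  exact ⟨fun h => (add_left_cancel'_s7 h).symm, fun h => by rw [h]⟩

theorem IsGyroHom.lcoset_subset [Gyrogroup G] {A : Type v} [Gyrogroup A] {φ : G → A}
    (hφ : IsGyroHom φ) {x y : G} (h : φ x = φ y) :
    lcoset x (gyroKer φ) ⊆ lcoset y (gyroKer φ) := by
  rintro _ ⟨n, hn, rfl⟩
  refine ⟨-y + (x + n), ?_, add_neg_cancel_left'_s7 y (x + n)⟩
  have hn' : φ n = 0 := hn
  rw [hφ.neg_add_mem_gyroKer_iff, hφ, hn', add_zero'_s7, h]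

theorem IsGyroHom.lcoset_eq_iff [Gyrogroup G] {A : Type v} [Gyrogroup A] {φ : G → A}
    (hφ : IsGyroHom φ) (x y : G) :
    lcoset x (gyroKer φ) = lcoset y (gyroKer φ) ↔ φ x = φ y := by
  refine ⟨fun h => ?_, fun h =>
    (hφ.lcoset_subset h).antisymm (hφ.lcoset_subset h.symm)⟩
  have hx : x ∈ lcoset y (gyroKer φ) := h ▸ ⟨0, hφ.map_zero_s7, add_zero'_s7 x⟩
  obtain ⟨n, hn, rfl⟩ := hx
  have hn' : φ n = 0 := hn
  change φ (y + n) = φ y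
  rw [hφ, hn', add_zero'_s7]

/-- Left cosets of a normal subgyrogroup agree exactly when the difference lies in it. -/
theorem IsNormalSubgyrogroup.lcoset_eq_iff [Gyrogroup G] {N : Set G}
    (hN : IsNormalSubgyrogroup N) (x y : G) : lcoset x N = lcoset y N ↔ -x + y ∈ N := by
  obtain ⟨-, A, _, φ, hφ, rfl⟩ := hN
  rw [hφ.lcoset_eq_iff, hφ.neg_add_mem_gyroKer_iff]

/-- for a normal subgyrogroup `N`, the quotient `G/N` is
gyrocommutative iff `⟨⟨G'⟩⟩ ⊆ N`. -/
theorem quotient_gyrocommutative_iff_normal_closure_subset [Gyrogroup G]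
    (GP K N : Set G) (hGP : IsCommutatorSubgyrogroup GP)
    (hK : IsGyroNormalClosure GP K) (hN : IsNormalSubgyrogroup N) :
    (∀ a b : G, lcoset (a + b) N = lcoset (gyr a b (b + a)) N) ↔ K ⊆ N := by
  simp only [hN.lcoset_eq_iff]
  constructor
  · intro h
    refine hK.2.2 N hN (hGP.2.2 N hN.1 ?_)
    rintro _ ⟨a, b, rfl⟩
    exact h a b
  · intro h a b
    exact h (hK.2.1 (hGP.2.1 ⟨a, b, rfl⟩))
end

section
/- Let G be a gyrogroup. The normal closure ⟨⟨G′⟩⟩ of the commutator subgyrogroup G′ is a subgroup of G, i.e., (⟨⟨G′⟩⟩, ⊕) is a group (in particular, ⊕ is associative on ⟨⟨G′⟩⟩). -/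
universe u v

open Gyrogroup

variable {G : Type u}

/-- In a group with a distinguished set `S` closed under inversion and under
`(a, b) ↦ a * b * a`, the elements `t` with `t * S ⊆ S` form a subgroup. -/
def twistedStabilizer {M : Type v} [Group M] (S : Set M)
    (h_inv : ∀ a ∈ S, a⁻¹ ∈ S) (sandwich : ∀ a ∈ S, ∀ b ∈ S, a * b * a ∈ S) : Subgroup M where
  carrier := {t | ∀ v ∈ S, t * v ∈ S}
  one_mem' := fun v hv => by simpa using hv
  mul_mem' := fun {s t} hs ht v hv => by
    rw [mul_assoc]
    exact hs _ (ht _ hv)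
  inv_mem' := fun {t} ht v hv => by
    have h := h_inv _ (sandwich _ (h_inv _ hv) _ (ht _ hv))
    convert h using 1
    group

namespace Gyrogroup

variable [Gyrogroup G]

theorem gyr_neg_left (a c : G) : gyr (-a) a c = c := by
  rw [← left_loop', neg_add', gyr_zero_left]

theorem neg_neg' (a : G) : - -a = a := by
  have h := neg_add_cancel_left' (-a) a
  rwa [neg_add', add_zero'] at h

/-- The left gyrotranslation by `a`. -/
def leftTranslation (a : G) : Equiv.Perm G where
  toFun x := a + x
  invFun x := -a + x
  left_inv := neg_add_cancel_left' a
  right_inv := add_neg_cancel_left' a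

local notation "L" => leftTranslation

@[simp] theorem leftTranslation_apply (a x : G) : L a x = a + x := rfl

theorem leftTranslation_neg (a : G) : L (-a) = (L a)⁻¹ :=
  Equiv.ext fun _ => rfl

theorem leftTranslation_zero : L (0 : G) = 1 := Equiv.ext zero_add'

theorem leftTranslation_mul (a b : G) : L a * L b = L (a + b) * gyr a b :=
  Equiv.ext fun c => add_gyr_assoc' a b c

theorem gyr_eq (a b : G) : gyr a b = (L (a + b))⁻¹ * (L a * L b) := by
  rw [leftTranslation_mul, inv_mul_cancel_left]

theorem gyr_mul_leftTranslation (a b w : G) : gyr a b * L w = L (gyr a b w) * gyr a b :=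
  Equiv.ext fun c => gyr_add' a b w c

theorem gyr_mul_gyr_add (a b : G) : gyr a (b + a) * gyr b a = 1 := by
  have h1 : gyr a (b + a) = gyr (-b) (b + a) := by
    rw [← left_loop' (-b), neg_add_cancel_left']
  rw [h1, gyr_eq (-b), gyr_eq b, neg_add_cancel_left', leftTranslation_neg]
  group

theorem leftTranslation_sandwich (a b : G) : L a * L b * L a = L (a + (b + a)) := by
  rw [mul_assoc, leftTranslation_mul b a, ← mul_assoc, leftTranslation_mul, mul_assoc,
    gyr_mul_gyr_add, mul_one]

theorem gyr_inv_eq_gyr_neg (a b : G) : (gyr a b)⁻¹ = gyr (-b) (-a) := by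
  have h : L (-b) * L (-a) = L ((gyr a b)⁻¹ (-(a + b))) * (gyr a b)⁻¹ := by
    have h1 : L (-b) * L (-a) = (L a * L b)⁻¹ := by
      rw [mul_inv_rev, leftTranslation_neg, leftTranslation_neg]
    rw [h1, leftTranslation_mul, mul_inv_rev, ← leftTranslation_neg, inv_mul_eq_iff_eq_mul,
      ← mul_assoc, gyr_mul_leftTranslation, Equiv.Perm.coe_inv, Equiv.apply_symm_apply, mul_inv_cancel_right]
  have h0 := congrArg (fun σ : Equiv.Perm G => σ 0) h
  have hz : (gyr a b)⁻¹ 0 = 0 := by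
    rw [Equiv.Perm.inv_eq_iff_eq]
    refine add_left_cancel' (a := gyr a b 0) ?_
    rw [← gyr_add', add_zero', add_zero']
  simp only [Equiv.Perm.mul_apply, leftTranslation_apply, add_zero', hz] at h0
  rw [← h0, leftTranslation_mul] at h
  exact (mul_left_cancel h).symm

theorem exists_add_eq (a c : G) : ∃ b : G, b + a = c := by
  refine ⟨-a + ((a + c) + -a), ?_⟩
  have h := congrArg (fun σ : Equiv.Perm G => σ a) (leftTranslation_sandwich (-a) (a + c))
  simp only [Equiv.Perm.mul_apply, leftTranslation_apply, neg_add', add_zero',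
    neg_add_cancel_left'] at h
  exact h.symm

theorem gyr_neg_neg (a c : G) : gyr (-a) (-c) = gyr a c := by
  obtain ⟨b, rfl⟩ := exists_add_eq a c
  rw [← gyr_inv_eq_gyr_neg, left_loop', inv_eq_iff_mul_eq_one]
  exact mul_eq_one_comm.mp (gyr_mul_gyr_add a b)

theorem gyr_inv_eq (a b : G) : (gyr a b)⁻¹ = gyr b a := by
  rw [gyr_inv_eq_gyr_neg, gyr_neg_neg]

theorem inv_mem_range_leftTranslation (σ : Equiv.Perm G)
    (hσ : σ ∈ Set.range (leftTranslation (G := G))) :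
    σ⁻¹ ∈ Set.range (leftTranslation (G := G)) := by
  obtain ⟨a, rfl⟩ := hσ
  exact ⟨-a, leftTranslation_neg a⟩

theorem sandwich_mem_range_leftTranslation (σ : Equiv.Perm G)
    (hσ : σ ∈ Set.range (leftTranslation (G := G))) (τ : Equiv.Perm G)
    (hτ : τ ∈ Set.range (leftTranslation (G := G))) :
    σ * τ * σ ∈ Set.range (leftTranslation (G := G)) := by
  obtain ⟨a, rfl⟩ := hσ
  obtain ⟨b, rfl⟩ := hτ
  exact ⟨_, (leftTranslation_sandwich a b).symm⟩

variable (G) in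
/-- The group of left gyrotranslations by elements of the left nucleus. -/
def nuclearTranslations : Subgroup (Equiv.Perm G) :=
  twistedStabilizer (Set.range leftTranslation)
    inv_mem_range_leftTranslation sandwich_mem_range_leftTranslation

theorem leftTranslation_nuclear_apply {t : Equiv.Perm G} (ht : t ∈ nuclearTranslations G) (a : G) :
    L (t a) = t * L a := by
  obtain ⟨u, hu⟩ := ht (L a) ⟨a, rfl⟩
  have h := congrArg (fun σ : Equiv.Perm G => σ 0) hu
  simp only [Equiv.Perm.mul_apply, leftTranslation_apply, add_zero'] at h
  rw [← h, hu]

theorem nuclear_apply_add {t : Equiv.Perm G} (ht : t ∈ nuclearTranslations G) (a b : G) :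
    t a + b = t (a + b) :=
  congrArg (fun σ : Equiv.Perm G => σ b) (leftTranslation_nuclear_apply ht a)

theorem leftTranslation_mem_nuclear_iff (n : G) :
    L n ∈ nuclearTranslations G ↔ n ∈ leftNucleus G := by
  constructor
  · intro hn b c
    exact (nuclear_apply_add hn b c).symm
  · rintro hn _ ⟨v, rfl⟩
    exact ⟨n + v, Equiv.ext fun c => (hn v c).symm⟩

theorem conj_mem_nuclear {t : Equiv.Perm G} (ht : t ∈ nuclearTranslations G) (x : G) :
    L x * t * (L x)⁻¹ ∈ nuclearTranslations G := by
  intro v hv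
  have h := sandwich_mem_range_leftTranslation (L x) ⟨x, rfl⟩ _
    (ht _ (sandwich_mem_range_leftTranslation (L (-x)) ⟨-x, rfl⟩ v hv))
  convert h using 1
  rw [leftTranslation_neg]
  group

theorem gyroCommutator_mem_leftNucleus (a b : G) : gyroCommutator a b ∈ leftNucleus G := by
  set x := a + b with hx
  set y := gyr a b (b + a) with hy
  have hba : L b * L a = (gyr a b)⁻¹ * L y := by
    rw [eq_inv_mul_iff_mul_eq, leftTranslation_mul, ← mul_assoc, gyr_mul_leftTranslation,
      mul_assoc, ← gyr_inv_eq a b, mul_inv_cancel, mul_one]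
  have key (v : G) : L v * (L y * (L x)⁻¹) ∈ Set.range (leftTranslation (G := G)) := by
    have h := sandwich_mem_range_leftTranslation (L (-x)) ⟨_, rfl⟩ _
      (sandwich_mem_range_leftTranslation (L a) ⟨_, rfl⟩ _
        (sandwich_mem_range_leftTranslation (L b) ⟨_, rfl⟩ (L ((gyr a b)⁻¹ v)) ⟨_, rfl⟩))
    convert h using 1
    have hw : L v * gyr a b = gyr a b * L ((gyr a b)⁻¹ v) := by
      rw [gyr_mul_leftTranslation, Equiv.Perm.coe_inv, Equiv.apply_symm_apply]
    calc L v * (L y * (L x)⁻¹)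
        = (L v * gyr a b) * ((gyr a b)⁻¹ * L y) * (L x)⁻¹ := by group
      _ = (L x)⁻¹ * (L x * gyr a b) * L ((gyr a b)⁻¹ v) * (L b * L a) * (L x)⁻¹ := by
          rw [hw, hba]
          group
      _ = _ := by
          rw [hx, ← leftTranslation_mul, leftTranslation_neg]
          group
  have hs : L y * (L x)⁻¹ ∈ nuclearTranslations G := by
    rintro _ ⟨v, rfl⟩
    have h := sandwich_mem_range_leftTranslation (L v) ⟨v, rfl⟩ _ (key (-v))
    convert h using 1
    rw [leftTranslation_neg]
    group
  have hk := conj_mem_nuclear hs (-x)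
  have e : L (-x) * (L y * (L x)⁻¹) * (L (-x))⁻¹ = L (-x) * L y := by
    rw [leftTranslation_neg]
    group
  rw [e] at hk
  rw [← leftTranslation_mem_nuclear_iff]
  have h0 := leftTranslation_nuclear_apply hk 0
  rw [leftTranslation_zero, mul_one, Equiv.Perm.mul_apply, leftTranslation_apply,
    leftTranslation_apply, add_zero'] at h0
  rw [← h0] at hk
  exact hk

theorem isSubgyrogroup_leftNucleus : IsSubgyrogroup (leftNucleus G) where
  nonempty := ⟨0, fun b c => by rw [zero_add', zero_add']⟩
  add_mem := fun a ha b hb => by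
    rw [← leftTranslation_mem_nuclear_iff] at *
    have h : L (a + b) = L a * L b := leftTranslation_nuclear_apply ha b
    rw [h]
    exact mul_mem ha hb
  neg_mem := fun a ha => by
    rw [← leftTranslation_mem_nuclear_iff] at *
    rw [leftTranslation_neg]
    exact inv_mem ha

variable (G) in
/-- The orbit relation of the nuclear left gyrotranslations. -/
def nuclearSetoid : Setoid G where
  r a b := ∃ t ∈ nuclearTranslations G, b = t a
  iseqv :=
    { refl := fun _ => ⟨1, one_mem _, rfl⟩
      symm := by
        rintro a _ ⟨t, ht, rfl⟩
        exact ⟨t⁻¹, inv_mem ht, by simp⟩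
      trans := by
        rintro a _ _ ⟨t, ht, rfl⟩ ⟨s, hs, rfl⟩
        exact ⟨s * t, mul_mem hs ht, rfl⟩ }

theorem nuclearSetoid_add {a a' b b' : G} (ha : nuclearSetoid G a a') (hb : nuclearSetoid G b b') :
    nuclearSetoid G (a + b) (a' + b') := by
  obtain ⟨s, hs, rfl⟩ := ha
  obtain ⟨t, ht, rfl⟩ := hb
  refine ⟨s * (L a * t * (L a)⁻¹), mul_mem hs (conj_mem_nuclear ht a), ?_⟩
  rw [nuclear_apply_add hs]
  simp [← leftTranslation_neg, neg_add_cancel_left']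

theorem nuclearSetoid_neg {a a' : G} (ha : nuclearSetoid G a a') :
    nuclearSetoid G (-a) (-a') := by
  obtain ⟨t, ht, rfl⟩ := ha
  refine ⟨_, conj_mem_nuclear (inv_mem ht) (-a), ?_⟩
  have h : L (-(t a)) = L (-a) * t⁻¹ := by
    rw [leftTranslation_neg, leftTranslation_nuclear_apply ht, mul_inv_rev, leftTranslation_neg]
  have h0 := congrArg (fun σ : Equiv.Perm G => σ 0) h
  simp only [leftTranslation_apply, add_zero'] at h0
  rw [h0, ← leftTranslation_neg, neg_neg']
  simp [leftTranslation_neg, add_neg']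

theorem neg_add_add_eq_gyr (a b c : G) : -(a + b) + (a + (b + c)) = gyr a b c := by
  rw [add_gyr_assoc' a b c, neg_add_cancel_left']

/-- The quotient of a gyrogroup by the orbits of its left nucleus. -/
@[reducible]
def nuclearQuotient : Gyrogroup (Quotient (nuclearSetoid G)) :=
  letI : Add (Quotient (nuclearSetoid G)) :=
    ⟨Quotient.map₂ (· + ·) fun _ _ ha _ _ hb => nuclearSetoid_add ha hb⟩
  letI : Neg (Quotient (nuclearSetoid G)) := ⟨Quotient.map (- ·) fun _ _ ha => nuclearSetoid_neg ha⟩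
  letI : Zero (Quotient (nuclearSetoid G)) := ⟨Quotient.mk _ 0⟩
  have inv (A B C : Quotient (nuclearSetoid G)) :
      -(B + A) + (B + (A + (-(A + B) + (A + (B + C))))) = C := by
    induction A, B using Quotient.inductionOn₂ with | _ a b
    induction C using Quotient.inductionOn with | _ c
    refine congrArg (Quotient.mk (nuclearSetoid G)) ?_
    beta_reduce
    rw [neg_add_add_eq_gyr a b, neg_add_add_eq_gyr, ← gyr_inv_eq, Equiv.Perm.coe_inv, Equiv.symm_apply_apply]
  { zero_add' := fun A => by
      induction A using Quotient.inductionOn with | _ a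
      exact congrArg (Quotient.mk (nuclearSetoid G)) (zero_add' a)
    neg_add' := fun A => by
      induction A using Quotient.inductionOn with | _ a
      exact congrArg (Quotient.mk (nuclearSetoid G)) (neg_add' a)
    gyr := fun A B =>
      { toFun := fun C => -(A + B) + (A + (B + C))
        invFun := fun C => -(B + A) + (B + (A + C))
        left_inv := inv A B
        right_inv := inv B A }
    gyr_add' := fun A B X Y => by
      induction A, B using Quotient.inductionOn₂ with | _ a b
      induction X, Y using Quotient.inductionOn₂ with | _ x y
      refine congrArg (Quotient.mk (nuclearSetoid G)) ?_
      simp only [neg_add_add_eq_gyr, gyr_add']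
    add_gyr_assoc' := fun A B C => by
      induction A, B using Quotient.inductionOn₂ with | _ a b
      induction C using Quotient.inductionOn with | _ c
      refine congrArg (Quotient.mk (nuclearSetoid G)) ?_
      simp only [neg_add_add_eq_gyr, ← add_gyr_assoc']
    left_loop' := fun A B => by
      refine Equiv.ext fun C => ?_
      induction A, B using Quotient.inductionOn₂ with | _ a b
      induction C using Quotient.inductionOn with | _ c
      refine congrArg (Quotient.mk (nuclearSetoid G)) ?_
      simp only [neg_add_add_eq_gyr, left_loop'] }

theorem isNormalSubgyrogroup_leftNucleus : IsNormalSubgyrogroup (leftNucleus G) := by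
  refine ⟨isSubgyrogroup_leftNucleus, Quotient (nuclearSetoid G), nuclearQuotient,
    Quotient.mk _, fun _ _ => rfl, Set.ext fun n => ?_⟩
  change n ∈ leftNucleus G ↔ Quotient.mk (nuclearSetoid G) n = Quotient.mk _ 0
  rw [eq_comm, Quotient.eq, ← leftTranslation_mem_nuclear_iff]
  constructor
  · exact fun hn => ⟨L n, hn, (add_zero' n).symm⟩
  · rintro ⟨t, ht, rfl⟩
    rw [leftTranslation_nuclear_apply ht, leftTranslation_zero, mul_one]
    exact ht

end Gyrogroup

/-- the normal closure of the commutator subgyrogroup is a subgroup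
of `G` (a subgyrogroup on which the operation is associative, hence a group). -/
theorem normal_closure_commutator_is_subgroup [Gyrogroup G]
    (GP K : Set G) (hGP : IsCommutatorSubgyrogroup GP)
    (hK : IsGyroNormalClosure GP K) :
    IsSubgroupOfGyrogroup K := by
  have hGPN : GP ⊆ leftNucleus G := hGP.2.2 _ isSubgyrogroup_leftNucleus <| by
    rintro _ ⟨a, b, rfl⟩
    exact gyroCommutator_mem_leftNucleus a b
  have hKN : K ⊆ leftNucleus G := hK.2.2 _ isNormalSubgyrogroup_leftNucleus hGPN
  exact ⟨hK.1.1, fun a ha b _ c _ => hKN ha b c⟩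
end
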